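/- In the first order setting, let x ∈ D₂ be the exact solution of A₂x = f, A₁*x = g, πx = k, and let x̃ ∈ D₂ = D(A₂) ∩ D(A₁*) be a conforming approximation; set e := x − x̃ and define the weighted least squares functional F(x̃) := ‖k − πx̃‖²_{H₂} + (1 + c₂²)‖A₂x̃ − f‖²_{H₃} + (1 + c₁²)‖A₁*x̃ − g‖²_{H₁}. Then, with ‖e‖²_{D₂} := ‖e‖²_{H₂} + ‖A₂e‖²_{H₃} + ‖A₁*e‖²_{H₁}, the two-sided equivalence ‖e‖²_{D₂} ≤ F(x̃) ≤ (1 + max{c₁, c₂}²)‖e‖²_{D₂} holds. -/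

import Mathlib

open Submodule LinearPMap RealInnerProductSpace

noncomputable section

/-- The range of a partially defined linear operator, as a submodule. -/
def pRan {E F : Type*} [AddCommGroup E] [Module ℝ E] [AddCommGroup F] [Module ℝ F]
    (A : E →ₗ.[ℝ] F) : Submodule ℝ F :=
  LinearMap.range A.toFun

/-- The kernel of a partially defined linear operator, as a submodule of the ambient space. -/
def pKer {E F : Type*} [AddCommGroup E] [Module ℝ E] [AddCommGroup F] [Module ℝ F]
    (A : E →ₗ.[ℝ] F) : Submodule ℝ E :=
  (LinearMap.ker A.toFun).map A.domain.subtype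

variable {H₁ H₂ H₃ : Type*}
  [NormedAddCommGroup H₁] [InnerProductSpace ℝ H₁] [CompleteSpace H₁]
  [NormedAddCommGroup H₂] [InnerProductSpace ℝ H₂] [CompleteSpace H₂]
  [NormedAddCommGroup H₃] [InnerProductSpace ℝ H₃] [CompleteSpace H₃]

theorem mem_pKer_iff {E F : Type*} [AddCommGroup E] [Module ℝ E] [AddCommGroup F] [Module ℝ F]
    {A : E →ₗ.[ℝ] F} {y : E} : y ∈ pKer A ↔ ∃ hy : y ∈ A.domain, A ⟨y, hy⟩ = 0 := by
  constructor
  · rintro ⟨⟨y, hy⟩, h, rfl⟩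
    exact ⟨hy, h⟩
  · rintro ⟨hy, h⟩
    exact ⟨⟨y, hy⟩, h, rfl⟩

theorem exists_map_sub_eq_of_mem_pKer {E F : Type*} [AddCommGroup E] [Module ℝ E]
    [AddCommGroup F] [Module ℝ F] {A : E →ₗ.[ℝ] F} {y z : E} (hy : y ∈ A.domain)
    (hz : z ∈ pKer A) : ∃ h : y - z ∈ A.domain, A ⟨y - z, h⟩ = A ⟨y, hy⟩ := by
  obtain ⟨hzd, hz0⟩ := mem_pKer_iff.1 hz
  refine ⟨A.domain.sub_mem hy hzd, ?_⟩
  have h := A.map_sub ⟨y, hy⟩ ⟨z, hzd⟩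
  rwa [hz0, sub_zero] at h

/-- The kernel of the adjoint is the orthogonal complement of the range. -/
theorem pKer_adjoint {E F : Type*} [NormedAddCommGroup E] [InnerProductSpace ℝ E]
    [CompleteSpace E] [NormedAddCommGroup F] [InnerProductSpace ℝ F] {A : E →ₗ.[ℝ] F}
    (hA : Dense (A.domain : Set E)) : pKer (A†) = (pRan A)ᗮ := by
  ext y
  rw [mem_pKer_iff, mem_orthogonal']
  constructor
  · rintro ⟨hy, h⟩ _ ⟨v, rfl⟩
    have h' := adjoint_isFormalAdjoint hA ⟨y, hy⟩ v
    rw [h, inner_zero_left] at h'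
    exact h'.symm
  · intro h
    have h' : ∀ v : A.domain, ⟪(0 : E), (v : E)⟫ = ⟪y, A v⟫ := fun v => by
      rw [inner_zero_left]
      exact (h _ ⟨v, rfl⟩).symm
    have hy : y ∈ (A†).domain := mem_adjoint_domain_of_exists y ⟨0, h'⟩
    exact ⟨hy, adjoint_apply_eq hA ⟨y, hy⟩ h'⟩

/-- If `R ≤ N` and `R` admits an orthogonal projection, then any `d` orthogonal to `N ⊓ Rᗮ`
splits into a component in `R` and a component in `Nᗮ`. -/
theorem exists_mem_sub_mem_orthogonal {E : Type*} [NormedAddCommGroup E] [InnerProductSpace ℝ E]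
    {R N : Submodule ℝ E} [R.HasOrthogonalProjection] (hRN : R ≤ N) {d : E}
    (hd : d ∈ (N ⊓ Rᗮ)ᗮ) : ∃ a ∈ R, d - a ∈ Nᗮ := by
  obtain ⟨a, ha, w, hw, rfl⟩ := R.exists_add_mem_mem_orthogonal d
  refine ⟨a, ha, ?_⟩
  rw [add_sub_cancel_left, mem_orthogonal]
  intro n hn
  obtain ⟨r, hr, s, hs, rfl⟩ := R.exists_add_mem_mem_orthogonal n
  have hsN : s ∈ N := by simpa using N.sub_mem hn (hRN hr)
  have h₁ : ⟪s, a + w⟫ = 0 := (mem_orthogonal _ _).1 hd s ⟨hsN, hs⟩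
  rw [inner_add_right, (mem_orthogonal' _ _).1 hs a ha, zero_add] at h₁
  rw [inner_add_left, h₁, (mem_orthogonal _ _).1 hw r hr, add_zero]

theorem norm_sq_eq_add_of_sub_mem_orthogonal {E : Type*} [NormedAddCommGroup E]
    [InnerProductSpace ℝ E] {K : Submodule ℝ E} {e h : E} (hh : h ∈ K) (he : e - h ∈ Kᗮ) :
    ‖e‖ ^ 2 = ‖h‖ ^ 2 + ‖e - h‖ ^ 2 := by
  have := norm_add_sq_real h (e - h)
  rw [add_sub_cancel, (mem_orthogonal _ _).1 he h hh] at this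
  linarith

omit [CompleteSpace H₃] in
/-- Poincaré-type estimate on `D(A₂) ∩ D(A₁†)` for the part orthogonal to
`N(A₂) ∩ N(A₁†)`. -/
theorem norm_sq_le_of_mem_orthogonal_pKer_inf {A₁ : H₁ →ₗ.[ℝ] H₂} {A₂ : H₂ →ₗ.[ℝ] H₃}
    (hdense₁ : Dense (A₁.domain : Set H₁)) (hcomplex : pRan A₁ ≤ pKer A₂)
    (hrange₁ : IsClosed (pRan A₁ : Set H₂)) {c₁ c₂ : ℝ}
    (hc₁ : ∀ w : (A₁†).domain, (w : H₂) ∈ (pKer (A₁†))ᗮ → ‖(w : H₂)‖ ≤ c₁ * ‖A₁† w‖)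
    (hc₂ : ∀ v : A₂.domain, (v : H₂) ∈ (pKer A₂)ᗮ → ‖(v : H₂)‖ ≤ c₂ * ‖A₂ v‖)
    {d : H₂} (hd₂ : d ∈ A₂.domain) (hd₁ : d ∈ (A₁†).domain)
    (hd : d ∈ (pKer A₂ ⊓ pKer (A₁†))ᗮ) :
    ‖d‖ ^ 2 ≤ c₂ ^ 2 * ‖A₂ ⟨d, hd₂⟩‖ ^ 2 + c₁ ^ 2 * ‖A₁† ⟨d, hd₁⟩‖ ^ 2 := by
  have : CompleteSpace (pRan A₁) := hrange₁.completeSpace_coe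
  have hker := pKer_adjoint hdense₁
  rw [hker] at hd
  obtain ⟨a, ha, hw⟩ := exists_mem_sub_mem_orthogonal hcomplex hd
  have hwR : d - a ∈ (pRan A₁)ᗮ := orthogonal_le hcomplex hw
  obtain ⟨hwd, hwA⟩ := exists_map_sub_eq_of_mem_pKer hd₂ (hcomplex ha)
  obtain ⟨had, haA⟩ := exists_map_sub_eq_of_mem_pKer hd₁ (hker ▸ hwR)
  have hw_le := hc₂ ⟨d - a, hwd⟩ hw
  have ha_le := hc₁ ⟨d - (d - a), had⟩ (by
    simp only [hker, sub_sub_cancel]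
    exact le_orthogonal_orthogonal _ ha)
  rw [hwA] at hw_le
  rw [haA] at ha_le
  simp only [sub_sub_cancel] at ha_le
  rw [norm_sq_eq_add_of_sub_mem_orthogonal ha hwR, ← mul_pow, ← mul_pow, add_comm]
  gcongr

/-- For a conforming approximation `xt ∈ D₂ = D(A₂) ∩ D(A₁†)` of the exact
solution `x`, the weighted least squares functional
`F(xt) = ‖k - π xt‖² + (1 + c₂²)‖A₂ xt - f‖² + (1 + c₁²)‖A₁† xt - g‖²`
is equivalent to the conforming error: with
`‖e‖²_{D₂} = ‖e‖² + ‖A₂ e‖² + ‖A₁† e‖²` one has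
`‖e‖²_{D₂} ≤ F(xt) ≤ (1 + max{c₁, c₂}²)‖e‖²_{D₂}` (here `kt = π xt`). -/
theorem statement17 (A₁ : H₁ →ₗ.[ℝ] H₂) (A₂ : H₂ →ₗ.[ℝ] H₃)
    (hdense₁ : Dense (A₁.domain : Set H₁)) (hdense₂ : Dense (A₂.domain : Set H₂))
    (hclosed₁ : A₁.IsClosed) (hclosed₂ : A₂.IsClosed)
    (hcomplex : pRan A₁ ≤ pKer A₂)
    (hrange₁ : IsClosed (pRan A₁ : Set H₂)) (hrange₂ : IsClosed (pRan A₂ : Set H₃))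
    (f : H₃) (g : H₁) (k : H₂)
    (hf : f ∈ pRan A₂) (hg : g ∈ pRan (A₁†)) (hk : k ∈ pKer A₂ ⊓ pKer (A₁†))
    -- `x ∈ D₂` is the exact solution: `A₂ x = f`, `A₁† x = g`, `π x = k`
    (x : H₂) (hx₂ : x ∈ A₂.domain) (hx₁ : x ∈ (A₁†).domain)
    (hxf : A₂ ⟨x, hx₂⟩ = f) (hxg : A₁† ⟨x, hx₁⟩ = g)
    (hxk : x - k ∈ (pKer A₂ ⊓ pKer (A₁†))ᗮ)
    -- `c₁, c₂` are the Friedrichs/Poincaré constants (also for the adjoints)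
    (c₁ c₂ : ℝ) (hc₁pos : 0 < c₁) (hc₂pos : 0 < c₂)
    (hc₁ : ∀ v : A₁.domain, (v : H₁) ∈ (pKer A₁)ᗮ → ‖(v : H₁)‖ ≤ c₁ * ‖A₁ v‖)
    (hc₁adj : ∀ w : (A₁†).domain, (w : H₂) ∈ (pKer (A₁†))ᗮ → ‖(w : H₂)‖ ≤ c₁ * ‖A₁† w‖)
    (hc₂ : ∀ v : A₂.domain, (v : H₂) ∈ (pKer A₂)ᗮ → ‖(v : H₂)‖ ≤ c₂ * ‖A₂ v‖)
    (hc₂adj : ∀ w : (A₂†).domain, (w : H₃) ∈ (pKer (A₂†))ᗮ → ‖(w : H₃)‖ ≤ c₂ * ‖A₂† w‖)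
    -- `xt ∈ D₂` is a conforming approximation
    (xt : H₂) (hxt₂ : xt ∈ A₂.domain) (hxt₁ : xt ∈ (A₁†).domain)
    -- `kt = π xt`
    (kt : H₂) (hkt : kt ∈ pKer A₂ ⊓ pKer (A₁†))
    (hktperp : xt - kt ∈ (pKer A₂ ⊓ pKer (A₁†))ᗮ) :
    ‖x - xt‖ ^ 2 + ‖A₂ ⟨x, hx₂⟩ - A₂ ⟨xt, hxt₂⟩‖ ^ 2 + ‖A₁† ⟨x, hx₁⟩ - A₁† ⟨xt, hxt₁⟩‖ ^ 2
      ≤ ‖k - kt‖ ^ 2 + (1 + c₂ ^ 2) * ‖A₂ ⟨xt, hxt₂⟩ - f‖ ^ 2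
        + (1 + c₁ ^ 2) * ‖A₁† ⟨xt, hxt₁⟩ - g‖ ^ 2
    ∧ ‖k - kt‖ ^ 2 + (1 + c₂ ^ 2) * ‖A₂ ⟨xt, hxt₂⟩ - f‖ ^ 2
        + (1 + c₁ ^ 2) * ‖A₁† ⟨xt, hxt₁⟩ - g‖ ^ 2
      ≤ (1 + max c₁ c₂ ^ 2) *
        (‖x - xt‖ ^ 2 + ‖A₂ ⟨x, hx₂⟩ - A₂ ⟨xt, hxt₂⟩‖ ^ 2
          + ‖A₁† ⟨x, hx₁⟩ - A₁† ⟨xt, hxt₁⟩‖ ^ 2) := by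
  have hh : k - kt ∈ pKer A₂ ⊓ pKer (A₁†) := sub_mem hk hkt
  have hd : x - xt - (k - kt) ∈ (pKer A₂ ⊓ pKer (A₁†))ᗮ := by
    rw [sub_sub_sub_comm]
    exact sub_mem hxk hktperp
  obtain ⟨hd₂, hdA₂⟩ := exists_map_sub_eq_of_mem_pKer (sub_mem hx₂ hxt₂) hh.1
  obtain ⟨hd₁, hdA₁⟩ := exists_map_sub_eq_of_mem_pKer (sub_mem hx₁ hxt₁) hh.2
  have hsub₂ : A₂ ⟨x - xt, sub_mem hx₂ hxt₂⟩ = A₂ ⟨x, hx₂⟩ - A₂ ⟨xt, hxt₂⟩ :=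
    A₂.map_sub ⟨x, hx₂⟩ ⟨xt, hxt₂⟩
  have hsub₁ : A₁† ⟨x - xt, sub_mem hx₁ hxt₁⟩ = A₁† ⟨x, hx₁⟩ - A₁† ⟨xt, hxt₁⟩ :=
    (A₁†).map_sub ⟨x, hx₁⟩ ⟨xt, hxt₁⟩
  have hle := norm_sq_le_of_mem_orthogonal_pKer_inf hdense₁ hcomplex hrange₁ hc₁adj hc₂
    hd₂ hd₁ hd
  rw [hdA₂, hdA₁, hsub₂, hsub₁] at hle
  have hpyth := norm_sq_eq_add_of_sub_mem_orthogonal hh hd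
  rw [← hxf, ← hxg, norm_sub_rev (A₂ ⟨xt, hxt₂⟩), norm_sub_rev (A₁† ⟨xt, hxt₁⟩)]
  refine ⟨by linarith, ?_⟩
  have hh_le : ‖k - kt‖ ^ 2 ≤ (1 + max c₁ c₂ ^ 2) * ‖x - xt‖ ^ 2 := by
    nlinarith [sq_nonneg ‖x - xt - (k - kt)‖, mul_nonneg (sq_nonneg (max c₁ c₂))
      (sq_nonneg ‖x - xt‖)]
  rw [mul_add, mul_add]
  gcongr
  · exact le_max_right _ _
  · exact le_max_left _ _
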